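/- Let X = (x₁ ⋯ x_n) be an integer d×n matrix whose columns span ℚ^d. Then there exists a matrix B = (b₁ ⋯ b_d) ∈ GL(d, ℤ) such that for every r ≤ n, if the first r columns x₁,…,x_r of X have rank s over ℚ, then the ℚ-span of x₁,…,x_r equals the ℚ-span of b₁,…,b_s. -/

import Mathlib

/-- The coordinatewise inclusion of `ℤ^d` in `ℚ^d`. -/
def castLin (d : ℕ) : (Fin d → ℤ) →ₗ[ℤ] (Fin d → ℚ) :=
  (Algebra.linearMap ℤ ℚ).compLeft (Fin d)

/-- The lattice of integer points of a rational subspace. -/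
def latt {d : ℕ} (V : Submodule ℚ (Fin d → ℚ)) : Submodule ℤ (Fin d → ℤ) :=
  (V.restrictScalars ℤ).comap (castLin d)

lemma mem_latt {d : ℕ} (V : Submodule ℚ (Fin d → ℚ)) (v : Fin d → ℤ) :
    v ∈ latt V ↔ (fun i => (v i : ℚ)) ∈ V := Iff.rfl

lemma latt_step {d : ℕ} (V : Submodule ℚ (Fin d → ℚ)) (x : Fin d → ℚ) (hx : x ∉ V) :
    ∃ b : Fin d → ℤ, latt (V ⊔ Submodule.span ℚ {x}) = latt V ⊔ Submodule.span ℤ {b} := by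
  obtain ⟨f, hfx, hf⟩ := Submodule.exists_le_ker_of_notMem hx
  have hker : ∀ w ∈ V ⊔ Submodule.span ℚ {x}, f w = 0 → w ∈ V := by
    intro w hw h0
    obtain ⟨v, hv, y, hy, rfl⟩ := Submodule.mem_sup.1 hw
    obtain ⟨a, rfl⟩ := Submodule.mem_span_singleton.1 hy
    have hfv : f v = 0 := hf hv
    have ha : a = 0 := by
      simpa [hfv, hfx] using h0
    simpa [ha] using hv
  obtain ⟨m, hm⟩ := IsLocalization.exist_integer_multiples (nonZeroDivisors ℤ) Finset.univ
    (fun i : Fin d => f (Pi.single i 1))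
  choose a ha using fun i => hm i (Finset.mem_univ i)
  have hm0 : ((m : ℤ) : ℚ) ≠ 0 := by
    exact_mod_cast nonZeroDivisors.ne_zero m.2
  let g : (Fin d → ℤ) →ₗ[ℤ] ℤ := Fintype.linearCombination ℤ a
  have hg : ∀ v, ((g v : ℤ) : ℚ) = (m : ℤ) * f (castLin d v) := by
    intro v
    have h1 : castLin d v = ∑ i, (v i : ℚ) • (Pi.single i 1 : Fin d → ℚ) := by
      ext j
      simp [castLin, Finset.sum_apply, Pi.single_apply]
    rw [h1, map_sum, Finset.mul_sum]
    simp only [g, Fintype.linearCombination_apply, Int.cast_sum]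
    refine Finset.sum_congr rfl fun i _ => ?_
    have hai : ((a i : ℤ) : ℚ) = (m : ℤ) * f (Pi.single i 1) :=
      (ha i).trans (zsmul_eq_mul _ _)
    rw [smul_eq_mul, Int.cast_mul, map_smul, hai, smul_eq_mul]
    ring
  obtain ⟨t, ht⟩ := (inferInstance :
    (Submodule.map g (latt (V ⊔ Submodule.span ℚ {x}))).IsPrincipal).principal
  have htm : t ∈ Submodule.map g (latt (V ⊔ Submodule.span ℚ {x})) := by
    rw [ht]; exact Submodule.mem_span_singleton_self t
  obtain ⟨b, hb, hbt⟩ := htm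
  refine ⟨b, le_antisymm ?_ ?_⟩
  · intro w hw
    have h2 : g w ∈ Submodule.map g (latt (V ⊔ Submodule.span ℚ {x})) := ⟨w, hw, rfl⟩
    rw [ht] at h2
    obtain ⟨k, hk⟩ := Submodule.mem_span_singleton.1 h2
    have h3 : w - k • b ∈ latt (V ⊔ Submodule.span ℚ {x}) :=
      Submodule.sub_mem _ hw (Submodule.smul_mem _ _ hb)
    have h4 : g (w - k • b) = 0 := by
      rw [map_sub, map_smul, hbt, hk, sub_self]
    have h5 : w - k • b ∈ latt V := by
      refine hker _ h3 ?_
      have := hg (w - k • b)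
      rw [h4] at this
      have h6 : ((m : ℤ) : ℚ) * f (castLin d (w - k • b)) = 0 := by simpa using this.symm
      exact (mul_eq_zero.1 h6).resolve_left hm0
    rw [← sub_add_cancel w (k • b)]
    exact Submodule.add_mem_sup h5 (Submodule.smul_mem _ _ (Submodule.mem_span_singleton_self b))
  · refine sup_le ?_ ?_
    · intro v hv
      exact (le_sup_left : V ≤ V ⊔ Submodule.span ℚ {x}) hv
    · rw [Submodule.span_singleton_le_iff_mem]
      exact hb

lemma exists_seq {d n : ℕ} (c : Fin n → (Fin d → ℚ)) (r0 : ℕ) (hr0 : r0 ≤ n) :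
    ∃ b : ℕ → (Fin d → ℤ), ∀ r ≤ r0,
      latt (Submodule.span ℚ (c '' {j | (j : ℕ) < r})) =
      Submodule.span ℤ (b '' {j | j < Module.finrank ℚ
        (Submodule.span ℚ (c '' {j | (j : ℕ) < r}))}) := by
  induction r0 with
  | zero =>
    refine ⟨fun _ => 0, fun r hr => ?_⟩
    obtain rfl : r = 0 := by omega
    have h1 : {j : Fin n | (j : ℕ) < 0} = ∅ := by ext j; simp
    have h2 : {j : ℕ | j < 0} = ∅ := by ext j; simp
    rw [h1, Set.image_empty, Submodule.span_empty, finrank_bot, h2, Set.image_empty,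
      Submodule.span_empty, eq_bot_iff]
    intro v hv
    rw [mem_latt, Submodule.mem_bot] at hv
    rw [Submodule.mem_bot]
    ext i
    have := congrFun hv i
    simpa using this
  | succ k ih =>
    obtain ⟨b, hb⟩ := ih (by omega)
    have hset : {j : Fin n | (j : ℕ) < k + 1} = insert ⟨k, by omega⟩ {j : Fin n | (j : ℕ) < k} := by
      ext j
      simp [Fin.ext_iff]
      omega
    set V := Submodule.span ℚ (c '' {j | (j : ℕ) < k}) with hV
    have hVs : Submodule.span ℚ (c '' {j | (j : ℕ) < k + 1}) =
        V ⊔ Submodule.span ℚ {c ⟨k, by omega⟩} := by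
      rw [hset, Set.image_insert_eq, Submodule.span_insert, sup_comm]
    by_cases hx : c ⟨k, by omega⟩ ∈ V
    · refine ⟨b, fun r hr => ?_⟩
      rcases Nat.lt_or_ge k r with h | h
      · obtain rfl : r = k + 1 := by omega
        have : V ⊔ Submodule.span ℚ {c ⟨k, by omega⟩} = V :=
          sup_eq_left.2 ((Submodule.span_singleton_le_iff_mem _ _).2 hx)
        rw [hVs, this]
        exact hb k le_rfl
      · exact hb r h
    · obtain ⟨y, hy⟩ := latt_step V _ hx
      have himg : ∀ s ≤ Module.finrank ℚ V,
          Function.update b (Module.finrank ℚ V) y '' {j | j < s} = b '' {j | j < s} := by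
        intro s hs
        refine Set.image_congr fun j hj => ?_
        have : j < s := hj
        exact Function.update_of_ne (by omega) _ _
      refine ⟨Function.update b (Module.finrank ℚ V) y, fun r hr => ?_⟩
      rcases Nat.lt_or_ge k r with h | h
      · obtain rfl : r = k + 1 := by omega
        have hfr : Module.finrank ℚ ↥(V ⊔ Submodule.span ℚ {c ⟨k, by omega⟩}) =
            Module.finrank ℚ V + 1 := by
          exact Submodule.finrank_sup_span_singleton hx
        rw [hVs, hfr, hy, hb k le_rfl]
        have : {j | j < Module.finrank ℚ V + 1} =
            insert (Module.finrank ℚ V) {j | j < Module.finrank ℚ V} := by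
          ext j
          simp
          omega
        rw [this, Set.image_insert_eq, Submodule.span_insert, sup_comm, himg _ le_rfl,
          Function.update_self]
      · rw [himg]
        · exact hb r h
        · refine Submodule.finrank_mono (Submodule.span_mono (Set.image_mono ?_))
          intro j hj
          exact lt_of_lt_of_le hj h

/-- Given an integer `d × n` matrix `X` whose columns span `ℚ^d`, there is a matrix
`B ∈ GL(d, ℤ)` such that for every `r ≤ n`, if the first `r` columns of `X` have rank `s`
over `ℚ`, then their `ℚ`-span equals the `ℚ`-span of the first `s` columns of `B`. -/
theorem exists_glz_adapted_to_column_filtration {d n : ℕ} (X : Matrix (Fin d) (Fin n) ℤ)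
    (hspan : Submodule.span ℚ
      (Set.range fun j : Fin n => fun i => (X i j : ℚ)) = ⊤) :
    ∃ B : Matrix (Fin d) (Fin d) ℤ, IsUnit B.det ∧
      ∀ r : ℕ, r ≤ n → ∀ s : ℕ,
        Module.finrank ℚ (Submodule.span ℚ
          ((fun j : Fin n => fun i => (X i j : ℚ)) '' {j | (j : ℕ) < r})) = s →
        Submodule.span ℚ ((fun j : Fin n => fun i => (X i j : ℚ)) '' {j | (j : ℕ) < r}) =
        Submodule.span ℚ ((fun j : Fin d => fun i => (B i j : ℚ)) '' {j | (j : ℕ) < s}) := by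
  obtain ⟨b, hb⟩ := exists_seq (fun j : Fin n => fun i => (X i j : ℚ)) n le_rfl
  have hle : ∀ r : ℕ, Module.finrank ℚ (Submodule.span ℚ
      ((fun j : Fin n => fun i => (X i j : ℚ)) '' {j | (j : ℕ) < r})) ≤ d := by
    intro r
    simpa using Submodule.finrank_le (Submodule.span ℚ
      ((fun j : Fin n => fun i => (X i j : ℚ)) '' {j | (j : ℕ) < r}))
  have himg : ∀ s ≤ d, b '' {j | j < s} = (fun j : Fin d => b j) '' {j | (j : ℕ) < s} := by
    intro s hs
    ext v
    constructor
    · rintro ⟨j, hj, rfl⟩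
      exact ⟨⟨j, lt_of_lt_of_le hj hs⟩, hj, rfl⟩
    · rintro ⟨j, hj, rfl⟩
      exact ⟨j, hj, rfl⟩
  refine ⟨Matrix.of fun i j => b j i, ?_, ?_⟩
  · have htop := hb n le_rfl
    have hu : {j : Fin n | (j : ℕ) < n} = Set.univ := by ext j; simp
    have hu' : {j : Fin d | (j : ℕ) < d} = Set.univ := by ext j; simp
    rw [hu, Set.image_univ, hspan, finrank_top, Module.finrank_fin_fun, himg d le_rfl, hu',
      Set.image_univ] at htop
    rw [← Matrix.isUnit_iff_isUnit_det, ← Matrix.mulVec_surjective_iff_isUnit]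
    intro v
    have hv : v ∈ Submodule.span ℤ (Set.range fun j : Fin d => b j) := by
      rw [← htop, mem_latt]; trivial
    obtain ⟨a, ha⟩ := (Submodule.mem_span_range_iff_exists_fun ℤ).1 hv
    refine ⟨a, ?_⟩
    rw [← ha]
    ext i
    simp [Matrix.mulVec, dotProduct, Finset.sum_apply, mul_comm]
  · rintro r hr s rfl
    have h := hb r hr
    have hd := hle r
    rw [himg _ hd] at h
    set s := Module.finrank ℚ (Submodule.span ℚ
      ((fun j : Fin n => fun i => (X i j : ℚ)) '' {j | (j : ℕ) < r})) with hs
    apply le_antisymm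
    · rw [Submodule.span_le]
      rintro _ ⟨j, hj, rfl⟩
      have h1 : (fun i => X i j) ∈ latt (Submodule.span ℚ
          ((fun j : Fin n => fun i => (X i j : ℚ)) '' {j | (j : ℕ) < r})) :=
        Submodule.subset_span ⟨j, hj, rfl⟩
      rw [h] at h1
      have h2 : Submodule.span ℤ ((fun j : Fin d => b j) '' {j | (j : ℕ) < s}) ≤
          latt (Submodule.span ℚ ((fun j : Fin d => fun i =>
            ((Matrix.of (fun i (j : Fin d) => b j i) i j : ℤ) : ℚ)) '' {j | (j : ℕ) < s})) := by
        rw [Submodule.span_le]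
        rintro _ ⟨k, hk, rfl⟩
        exact Submodule.subset_span ⟨k, hk, rfl⟩
      exact h2 h1
    · rw [Submodule.span_le]
      rintro _ ⟨j, hj, rfl⟩
      have h1 : b j ∈ latt (Submodule.span ℚ
          ((fun j : Fin n => fun i => (X i j : ℚ)) '' {j | (j : ℕ) < r})) := by
        rw [h]
        exact Submodule.subset_span ⟨j, hj, rfl⟩
      exact h1
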